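/- For any two-dimensional convex lattice polygon Δ with exactly one lattice point in its interior, the Euclidean area of Δ is at most 9/2. -/

import Mathlib

open MeasureTheory

/-- The properties of the set of lattice points of `Δ` (with interior lattice point `0`) we use. -/
structure GoodPts (D : ℤ → ℤ → Prop) : Prop where
  hA : ∀ x1 x2 y1 y2 z1 z2 m n N : ℤ, D y1 y2 → D z1 z2 → 0 ≤ m → 0 ≤ n → m + n ≤ N → 0 < N →
    N * x1 = m * y1 + n * z1 → N * x2 = m * y2 + n * z2 → D x1 x2
  hB : ∀ x1 x2 y1 y2 z1 z2 m n N : ℤ, D y1 y2 → D z1 z2 → 0 ≤ m → 0 ≤ n → m + n < N →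
    N * x1 = m * y1 + n * z1 → N * x2 = m * y2 + n * z2 → x1 = 0 ∧ x2 = 0

theorem edge_normal (D : ℤ → ℤ → Prop) (g : GoodPts D) (h0 : D 1 0) (h3 : D 1 3)
    (hneg : ∃ a b, D a b ∧ a < 0) (B : Finset (ℤ × ℤ)) (hB : ∀ p ∈ B, D p.1 p.2 ∧ p ≠ 0) :
    B.card ≤ 9 := by
  have ha : ∀ a b, D a b → a ≤ 1 := by
    intro a b h
    by_contra hc
    push Not at hc
    rcases le_or_gt b a with hb | hb
    · have := g.hB 1 1 a b 1 3 2 (a - b) (3 * a - b) h h3 (by omega) (by omega) (by omega)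
        (by ring) (by ring)
      omega
    · have := g.hB 1 1 a b 1 0 1 (b - a) b h h0 (by omega) (by omega) (by omega)
        (by ring) (by ring)
      omega
  have hz : ∀ b, D 0 b → -1 ≤ b ∧ b ≤ 1 := by
    intro b h
    constructor
    · by_contra hc
      have := g.hB 0 (-1) 0 b 0 b 1 0 (-b) h h (by omega) (by omega) (by omega)
        (by ring) (by ring)
      omega
    · by_contra hc
      have := g.hB 0 1 0 b 0 b 1 0 b h h (by omega) (by omega) (by omega)
        (by ring) (by ring)
      omega
  have hk : ∀ k b j, 1 ≤ k → D (-k) b → D 1 j → -(k + 1) ≤ k * j + b ∧ k * j + b ≤ k + 1 := by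
    intro k b j hk h h'
    constructor
    · by_contra hc
      have := g.hB 0 (-1) 1 j (-k) b k 1 (-(k * j + b)) h' h (by omega) (by omega) (by omega)
        (by ring) (by ring)
      omega
    · by_contra hc
      have := g.hB 0 1 1 j (-k) b k 1 (k * j + b) h' h (by omega) (by omega) (by omega)
        (by ring) (by ring)
      omega
  have hn : ∀ a b, D a b → a < 0 → (a = -1 ∧ (b = -2 ∨ b = -1)) ∨ (a = -2 ∧ b = -3) := by
    intro a b h han
    have e0 := hk (-a) b 0 (by omega) (by simpa using h) h0
    have e3 := hk (-a) b 3 (by omega) (by simpa using h) h3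
    omega
  have fin : ∀ S : Finset (ℤ × ℤ), S.card ≤ 9 → (∀ a b, D a b → (a ≠ 0 ∨ b ≠ 0) → (a, b) ∈ S) →
      B.card ≤ 9 := by
    intro S hS h
    refine le_trans (Finset.card_le_card ?_) hS
    rintro ⟨a, b⟩ hp
    obtain ⟨h1, h2⟩ := hB _ hp
    apply h a b h1
    by_contra hc
    push Not at hc
    exact h2 (by ext <;> simp [hc.1, hc.2])
  have hm1 : ∀ b j, D (-1) b → D 1 j → -2 ≤ j + b ∧ j + b ≤ 2 := by
    intro b j h h'
    have := hk 1 b j (by norm_num) h h'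
    omega
  by_cases c2 : D (-2) (-3)
  · have hj : ∀ j, D 1 j → 0 ≤ j ∧ j ≤ 3 := by
      intro j h
      have := hk 2 (-3) j (by norm_num) c2 h
      omega
    apply fin {(1,0),(1,1),(1,2),(1,3),(0,1),(0,-1),(-1,-2),(-1,-1),(-2,-3)} (by decide)
    intro a b h hne
    simp only [Finset.mem_insert, Finset.mem_singleton, Prod.mk.injEq]
    have h1 := ha a b h
    have h2 := hn a b h
    rcases lt_trichotomy a 0 with h3 | h3 | h3
    · omega
    · subst h3
      have := hz b h
      omega
    · obtain rfl : a = 1 := by omega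
      have := hj b h
      omega
  have hn' : ∀ a b, D a b → a < 0 → (a = -1 ∧ (b = -2 ∨ b = -1)) := by
    intro a b h han
    rcases hn a b h han with h' | ⟨rfl, rfl⟩
    · exact h'
    · exact absurd h c2
  by_cases c1 : D (-1) (-2)
  · apply fin {(1,0),(1,1),(1,2),(1,3),(1,4),(0,1),(0,-1),(-1,-2)} (by decide) |> fun f => ?_
    by_cases c3 : D (-1) (-1)
    · apply fin {(1,0),(1,1),(1,2),(1,3),(0,1),(0,-1),(-1,-2),(-1,-1)} (by decide)
      intro a b h hne
      simp only [Finset.mem_insert, Finset.mem_singleton, Prod.mk.injEq]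
      have h1 := ha a b h
      have h2 := hn' a b h
      rcases lt_trichotomy a 0 with h3 | h3 | h3
      · omega
      · subst h3
        have := hz b h
        omega
      · obtain rfl : a = 1 := by omega
        have := hm1 _ _ c1 h
        have := hm1 _ _ c3 h
        omega
    · apply f
      intro a b h hne
      simp only [Finset.mem_insert, Finset.mem_singleton, Prod.mk.injEq]
      have h1 := ha a b h
      have h2 := hn' a b h
      rcases lt_trichotomy a 0 with h3 | h3 | h3
      · obtain ⟨rfl, rfl | rfl⟩ := h2 h3
        · omega
        · exact absurd h c3
      · subst h3
        have := hz b h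
        omega
      · obtain rfl : a = 1 := by omega
        have := hm1 _ _ c1 h
        omega
  · have c3 : D (-1) (-1) := by
      obtain ⟨a, b, h, hlt⟩ := hneg
      obtain ⟨rfl, rfl | rfl⟩ := hn' a b h hlt
      · exact absurd h c1
      · exact h
    apply fin {(1,-1),(1,0),(1,1),(1,2),(1,3),(0,1),(0,-1),(-1,-1)} (by decide)
    intro a b h hne
    simp only [Finset.mem_insert, Finset.mem_singleton, Prod.mk.injEq]
    have h1 := ha a b h
    have h2 := hn' a b h
    rcases lt_trichotomy a 0 with h3 | h3 | h3
    · obtain ⟨rfl, rfl | rfl⟩ := h2 h3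
      · exact absurd h c1
      · omega
    · subst h3
      have := hz b h
      omega
    · obtain rfl : a = 1 := by omega
      have := hm1 _ _ c3 h
      omega

/-- A lattice point in the triangle `0, v, w` of determinant `≥ 2`. -/
theorem tri_point (v1 v2 w1 w2 d : ℤ) (hd : v1 * w2 - v2 * w1 = d) (h2 : 2 ≤ d) :
    ∃ x1 x2 a b : ℤ, d * x1 = a * v1 + b * w1 ∧ d * x2 = a * v2 + b * w2 ∧ 0 ≤ a ∧ 0 ≤ b ∧
      a < d ∧ b < d ∧ a + b ≤ d ∧ 0 < a + b := by
  have key : ∃ y1 y2 : ℤ, ¬ (d ∣ y1 * w2 - y2 * w1 ∧ d ∣ v1 * y2 - v2 * y1) := by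
    by_contra hc
    push Not at hc
    obtain ⟨⟨a, ha⟩, ⟨b, hb⟩⟩ := hc 1 0
    obtain ⟨⟨a', ha'⟩, ⟨b', hb'⟩⟩ := hc 0 1
    have e1 : w2 = d * a := by linarith
    have e2 : v2 = - (d * b) := by linarith
    have e3 : w1 = - (d * a') := by linarith
    have e4 : v1 = d * b' := by linarith
    have : d * (d * (b' * a - b * a') - 1) = 0 := by
      rw [e1, e2, e3, e4] at hd
      linarith
    have h1 : d * (b' * a - b * a') = 1 := by
      rcases mul_eq_zero.1 this with h | h <;> omega
    have := Int.eq_one_or_neg_one_of_mul_eq_one h1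
    omega
  obtain ⟨y1, y2, hy⟩ := key
  set P := y1 * w2 - y2 * w1 with hP
  set Q := v1 * y2 - v2 * y1 with hQ
  have dp : 0 < d := by omega
  have a0 := Int.emod_nonneg P dp.ne'
  have b0 := Int.emod_nonneg Q dp.ne'
  have a1 := Int.emod_lt_of_pos P dp
  have b1 := Int.emod_lt_of_pos Q dp
  have pe := Int.emod_add_mul_ediv P d
  have qe := Int.emod_add_mul_ediv Q d
  have hne : ¬ (P % d = 0 ∧ Q % d = 0) := fun h =>
    hy ⟨Int.dvd_of_emod_eq_zero h.1, Int.dvd_of_emod_eq_zero h.2⟩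
  set a := P % d
  set b := Q % d
  set k := P / d
  set l := Q / d
  have E1 : d * (y1 - k * v1 - l * w1) = a * v1 + b * w1 := by
    have : d * y1 = P * v1 + Q * w1 := by rw [hP, hQ, ← hd]; ring
    rw [← pe, ← qe] at this
    linarith
  have E2 : d * (y2 - k * v2 - l * w2) = a * v2 + b * w2 := by
    have : d * y2 = P * v2 + Q * w2 := by rw [hP, hQ, ← hd]; ring
    rw [← pe, ← qe] at this
    linarith
  by_cases hab : a + b ≤ d
  · exact ⟨_, _, a, b, E1, E2, a0, b0, a1, b1, hab, by omega⟩
  · refine ⟨v1 + w1 - (y1 - k * v1 - l * w1), v2 + w2 - (y2 - k * v2 - l * w2), d - a, d - b,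
      by linarith, by linarith, by omega, by omega, by omega, by omega, by omega, by omega⟩

theorem edge_pos (D : ℤ → ℤ → Prop) (g : GoodPts D) (v1 v2 u1 u2 : ℤ) (hu : IsCoprime u1 u2)
    (h0 : D v1 v2) (h1 : D (v1 + u1) (v2 + u2)) (h3 : D (v1 + 3 * u1) (v2 + 3 * u2))
    (hdet : 0 < v1 * u2 - v2 * u1)
    (hC : ∀ c1 c2 : ℝ, (c1 ≠ 0 ∨ c2 ≠ 0) → ∃ a b, D a b ∧ 0 < c1 * (a : ℝ) + c2 * (b : ℝ))
    (B : Finset (ℤ × ℤ)) (hB : ∀ p ∈ B, D p.1 p.2 ∧ p ≠ 0) :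
    B.card ≤ 9 := by
  have hd1 : v1 * u2 - v2 * u1 = 1 := by
    by_contra hne
    obtain ⟨x1, x2, a, b, e1, e2, a0, b0, ad, bd, hab, hab0⟩ :=
      tri_point v1 v2 (v1 + u1) (v2 + u2) (v1 * u2 - v2 * u1) (by ring) (by omega)
    set d := v1 * u2 - v2 * u1 with hd
    rcases hab.lt_or_eq with hlt | heq
    · obtain ⟨rfl, rfl⟩ := g.hB x1 x2 _ _ _ _ a b d h0 h1 a0 b0 hlt e1 e2
      have hb : b * d = 0 := by rw [hd]; linear_combination (-v1) * e2 + v2 * e1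
      have ha : a * d = 0 := by
        rw [hd]; linear_combination (-(v2 + u2)) * e1 + (v1 + u1) * e2
      have := (mul_eq_zero.1 hb).resolve_right hdet.ne'
      have := (mul_eq_zero.1 ha).resolve_right hdet.ne'
      omega
    · obtain ⟨s, t, hst⟩ := hu
      have : d ∣ b := by
        refine ⟨s * (x1 - v1) + t * (x2 - v2), ?_⟩
        linear_combination (-s) * e1 + (-t) * e2 + (-b) * hst - (s * v1 + t * v2) * heq
      have := Int.le_of_dvd (by omega) this
      omega
  let D' : ℤ → ℤ → Prop := fun a b => D (a * v1 + b * u1) (a * v2 + b * u2)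
  have g' : GoodPts D' := by
    constructor
    · intro x1 x2 y1 y2 z1 z2 m n N hy hz hm hn hmn hN e1 e2
      refine g.hA _ _ _ _ _ _ m n N hy hz hm hn hmn hN ?_ ?_
      · linear_combination v1 * e1 + u1 * e2
      · linear_combination v2 * e1 + u2 * e2
    · intro x1 x2 y1 y2 z1 z2 m n N hy hz hm hn hmn e1 e2
      obtain ⟨f1, f2⟩ := g.hB (x1 * v1 + x2 * u1) (x1 * v2 + x2 * u2) _ _ _ _ m n N hy hz hm hn hmn
        (by linear_combination v1 * e1 + u1 * e2) (by linear_combination v2 * e1 + u2 * e2)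
      constructor
      · linear_combination u2 * f1 - u1 * f2 - x1 * hd1
      · linear_combination v1 * f2 - v2 * f1 - x2 * hd1
  let φ : ℤ × ℤ → ℤ × ℤ := fun p => (p.1 * u2 - p.2 * u1, v1 * p.2 - v2 * p.1)
  have back1 : ∀ x y : ℤ, (x * u2 - y * u1) * v1 + (v1 * y - v2 * x) * u1 = x := by
    intro x y; linear_combination x * hd1
  have back2 : ∀ x y : ℤ, (x * u2 - y * u1) * v2 + (v1 * y - v2 * x) * u2 = y := by
    intro x y; linear_combination y * hd1
  have hinj : Function.Injective φ := by
    rintro ⟨a, b⟩ ⟨c, d⟩ h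
    simp only [φ, Prod.mk.injEq] at h
    ext
    · have := back1 a b
      rw [h.1, h.2, back1] at this
      exact this.symm
    · have := back2 a b
      rw [h.1, h.2, back2] at this
      exact this.symm
  rw [← Finset.card_image_of_injective B hinj]
  apply edge_normal D' g'
  · simpa [D'] using h0
  · simpa [D'] using h3
  · have hne : (-(u2 : ℝ) ≠ 0 ∨ (u1 : ℝ) ≠ 0) := by
      by_contra hc
      push Not at hc
      have r1 : u2 = 0 := by exact_mod_cast neg_eq_zero.1 hc.1
      have r2 : u1 = 0 := by exact_mod_cast hc.2
      rw [r1, r2] at hd1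
      omega
    obtain ⟨a, b, h, hp⟩ := hC _ _ hne
    refine ⟨a * u2 - b * u1, v1 * b - v2 * a, ?_, ?_⟩
    · simp only [D', back1, back2]; exact h
    · have : 0 < -u2 * a + u1 * b := by exact_mod_cast hp
      linarith
  · intro p hp
    obtain ⟨⟨x, y⟩, hq, rfl⟩ := Finset.mem_image.1 hp
    obtain ⟨q1, q2⟩ := hB _ hq
    refine ⟨?_, ?_⟩
    · simp only [D', φ, back1, back2]; exact q1
    · intro h
      apply q2
      apply hinj
      rw [h]
      simp [φ]
      rfl

theorem card_le_nine (D : ℤ → ℤ → Prop) (g : GoodPts D)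
    (hC : ∀ c1 c2 : ℝ, (c1 ≠ 0 ∨ c2 ≠ 0) → ∃ a b, D a b ∧ 0 < c1 * (a : ℝ) + c2 * (b : ℝ))
    (B : Finset (ℤ × ℤ)) (hB : ∀ p ∈ B, D p.1 p.2 ∧ p ≠ 0) :
    B.card ≤ 9 := by
  by_contra hcard
  push Not at hcard
  obtain ⟨p, hp, q, hq, hpq, heq⟩ := Finset.exists_ne_map_eq_of_card_lt_of_maps_to
    (s := B) (t := (Finset.univ : Finset (ZMod 3 × ZMod 3)))
    (f := fun p => ((p.1 : ZMod 3), (p.2 : ZMod 3))) (by simpa [ZMod.card] using hcard)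
    (by intro x _; simp)
  obtain ⟨v1, v2⟩ := p
  obtain ⟨q1, q2⟩ := q
  simp only [Prod.mk.injEq] at heq
  obtain ⟨z1, e1⟩ := (ZMod.intCast_eq_intCast_iff_dvd_sub _ _ 3).1 heq.1
  obtain ⟨z2, e2⟩ := (ZMod.intCast_eq_intCast_iff_dvd_sub _ _ 3).1 heq.2
  have hz : ¬ (z1 = 0 ∧ z2 = 0) := by
    rintro ⟨rfl, rfl⟩
    apply hpq
    ext
    · simp at e1 ⊢; linarith
    · simp at e2 ⊢; linarith
  obtain ⟨n, u1, u2, hn, hcop, f1, f2⟩ : ∃ n u1 u2 : ℤ, 0 < n ∧ IsCoprime u1 u2 ∧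
      z1 = n * u1 ∧ z2 = n * u2 := by
    have hg : 0 < Int.gcd z1 z2 := by
      rw [Nat.pos_iff_ne_zero, Ne, Int.gcd_eq_zero_iff]; exact hz
    obtain ⟨a, b, hc, ha, hb⟩ := Int.exists_gcd_one hg
    exact ⟨Int.gcd z1 z2, a, b, by exact_mod_cast hg, Int.isCoprime_iff_gcd_eq_one.2 hc,
      by linarith, by linarith⟩
  have hv := (hB _ hp).1
  have hw := (hB _ hq).1
  simp only at hv hw
  have w1 : q1 = v1 + 3 * n * u1 := by push_cast at e1; rw [f1] at e1; linarith
  have w2 : q2 = v2 + 3 * n * u2 := by push_cast at e2; rw [f2] at e2; linarith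
  have hi : ∀ i : ℤ, 0 ≤ i → i ≤ 3 * n → D (v1 + i * u1) (v2 + i * u2) := by
    intro i i0 i3
    refine g.hA _ _ _ _ _ _ (3 * n - i) i (3 * n) hv hw (by omega) (by omega) (by omega) (by omega)
      ?_ ?_
    · rw [w1]; ring
    · rw [w2]; ring
  rcases lt_trichotomy (v1 * u2 - v2 * u1) 0 with h | h | h
  · have := edge_pos D g (v1 + 3 * u1) (v2 + 3 * u2) (-u1) (-u2) hcop.neg_neg
      (hi 3 (by omega) (by omega)) (by convert hi 2 (by omega) (by omega) using 1 <;> ring)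
      (by convert hi 0 (by omega) (by omega) using 1 <;> ring) (by linarith) hC B hB
    omega
  · obtain ⟨s, t, hst⟩ := hcop
    obtain ⟨c, hc⟩ : ∃ c, c = s * v1 + t * v2 := ⟨_, rfl⟩
    have c1 : v1 = c * u1 := by
      rw [hc]; linear_combination (-v1) * hst + t * h
    have c2 : v2 = c * u2 := by
      rw [hc]; linear_combination (-v2) * hst - s * h
    have hu : ¬ (u1 = 0 ∧ u2 = 0) := by
      rintro ⟨rfl, rfl⟩; simp at hst
    have hb : ∀ e, D (e * u1) (e * u2) → -1 ≤ e ∧ e ≤ 1 := by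
      intro e he
      constructor
      · by_contra hcc
        have := g.hB (-u1) (-u2) _ _ _ _ 1 0 (-e) he he (by omega) (by omega) (by omega)
          (by ring) (by ring)
        omega
      · by_contra hcc
        have := g.hB u1 u2 _ _ _ _ 1 0 e he he (by omega) (by omega) (by omega)
          (by ring) (by ring)
        omega
    have b0 := hb c (by rw [← c1, ← c2]; exact hv)
    have b3 := hb (c + 3) (by
      convert hi 3 (by omega) (by omega) using 1
      · rw [c1]; ring
      · rw [c2]; ring)
    omega
  · have := edge_pos D g v1 v2 u1 u2 hcop
      hv (by convert hi 1 (by omega) (by omega) using 1 <;> ring)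
      (hi 3 (by omega) (by omega)) h hC B hB
    omega

theorem facet (D : ℤ → ℤ → Prop) (g : GoodPts D) (v1 v2 w1 w2 : ℤ) (hv : D v1 v2) (hw : D w1 w2)
    (hd : v1 * w2 - v2 * w1 = 1) (hs : ¬ D (v1 + w1) (v2 + w2)) (x1 x2 : ℤ) (hx : D x1 x2) :
    (x1 * w2 - x2 * w1) + (v1 * x2 - v2 * x1) ≤ 1 := by
  by_contra hc
  push Not at hc
  have e1 : x1 = (x1 * w2 - x2 * w1) * v1 + (v1 * x2 - v2 * x1) * w1 := by
    linear_combination (-x1) * hd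
  have e2 : x2 = (x1 * w2 - x2 * w1) * v2 + (v1 * x2 - v2 * x1) * w2 := by
    linear_combination (-x2) * hd
  set a := x1 * w2 - x2 * w1
  set b := v1 * x2 - v2 * x1
  have hv0 : ¬ (v1 = 0 ∧ v2 = 0) := by
    rintro ⟨rfl, rfl⟩; simp at hd
  have hw0 : ¬ (w1 = 0 ∧ w2 = 0) := by
    rintro ⟨rfl, rfl⟩; simp at hd
  rcases le_or_gt b 0 with hb | hb
  · exact hv0 (g.hB v1 v2 x1 x2 w1 w2 1 (-b) a hx hw (by omega) (by omega) (by omega)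
      (by linear_combination -e1) (by linear_combination -e2))
  rcases le_or_gt a 0 with ha | ha
  · exact hw0 (g.hB w1 w2 x1 x2 v1 v2 1 (-a) b hx hv (by omega) (by omega) (by omega)
      (by linear_combination -e1) (by linear_combination -e2))
  -- v + w is a combination of x, v, w
  rcases le_total a b with hab | hab
  · exact hs (g.hA _ _ v1 v2 x1 x2 (b - a) 1 b hv hx (by omega) (by omega) (by omega) (by omega)
      (by linear_combination -e1) (by linear_combination -e2))
  · exact hs (g.hA _ _ w1 w2 x1 x2 (a - b) 1 a hw hx (by omega) (by omega) (by omega) (by omega)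
      (by linear_combination -e1) (by linear_combination -e2))

theorem cone_exists (D : ℤ → ℤ → Prop) (g : GoodPts D)
    (hC : ∀ c1 c2 : ℝ, (c1 ≠ 0 ∨ c2 ≠ 0) → ∃ a b, D a b ∧ 0 < c1 * (a : ℝ) + c2 * (b : ℝ))
    (B : Finset (ℤ × ℤ)) (hB : ∀ p, p ∈ B ↔ D p.1 p.2 ∧ p ≠ 0) (p1 p2 : ℝ)
    (hp : p1 ≠ 0 ∨ p2 ≠ 0) :
    ∃ v ∈ B, ∃ w ∈ B, v.1 * w.2 - v.2 * w.1 = 1 ∧ ¬ D (v.1 + w.1) (v.2 + w.2) ∧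
      0 ≤ (v.1 : ℝ) * p2 - v.2 * p1 ∧ 0 ≤ p1 * w.2 - p2 * w.1 := by
  classical
  have hpp : 0 < p1 ^ 2 + p2 ^ 2 := by
    rcases hp with h | h
    · positivity
    · positivity
  have hCB : ∀ c1 c2 : ℝ, (c1 ≠ 0 ∨ c2 ≠ 0) → ∃ q ∈ B, 0 < c1 * (q.1 : ℝ) + c2 * (q.2 : ℝ) := by
    intro c1 c2 hc
    obtain ⟨a, b, h, hpos⟩ := hC c1 c2 hc
    refine ⟨(a, b), (hB _).2 ⟨h, ?_⟩, hpos⟩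
    intro h0
    have ha : a = 0 := congrArg Prod.fst h0
    have hb : b = 0 := congrArg Prod.snd h0
    simp [ha, hb] at hpos
  -- existence of some cone
  have hex : ∃ v ∈ B, ∃ w ∈ B, (0 : ℤ) < v.1 * w.2 - v.2 * w.1 ∧
      0 ≤ (v.1 : ℝ) * p2 - v.2 * p1 ∧ 0 ≤ p1 * w.2 - p2 * w.1 := by
    let L := B.filter (fun v => 0 < (v.1 : ℝ) * p2 - v.2 * p1)
    have hL : L.Nonempty := by
      obtain ⟨q, hq, h⟩ := hCB p2 (-p1) (by rcases hp with h | h; right; simpa; left; exact h)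
      exact ⟨q, Finset.mem_filter.2 ⟨hq, by linarith⟩⟩
    obtain ⟨v, hvL, hmax⟩ := L.exists_max_image
      (fun v => ((v.1 : ℝ) * p1 + v.2 * p2) / ((v.1 : ℝ) * p2 - v.2 * p1)) hL
    obtain ⟨hvB, hvp⟩ := Finset.mem_filter.1 hvL
    obtain ⟨w, hw, hvw⟩ := hCB (-(v.2 : ℝ)) (v.1 : ℝ) (by
      by_contra hc
      push Not at hc
      rw [hc.2, neg_eq_zero.1 hc.1] at hvp
      simp at hvp)
    refine ⟨v, hvB, w, hw, ?_, hvp.le, ?_⟩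
    · have : (0 : ℝ) < v.1 * w.2 - v.2 * w.1 := by linarith
      exact_mod_cast this
    · by_contra hc
      push Not at hc
      have hwp : 0 < (w.1 : ℝ) * p2 - w.2 * p1 := by linarith
      have := hmax w (Finset.mem_filter.2 ⟨hw, hwp⟩)
      rw [div_le_div_iff₀ hwp hvp] at this
      have h2 : 0 < (p1 ^ 2 + p2 ^ 2) * (-(v.2 : ℝ) * w.1 + v.1 * w.2) := mul_pos hpp hvw
      nlinarith
  let P := (B ×ˢ B).filter (fun q => (0 : ℤ) < q.1.1 * q.2.2 - q.1.2 * q.2.1 ∧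
      0 ≤ (q.1.1 : ℝ) * p2 - q.1.2 * p1 ∧ 0 ≤ p1 * q.2.2 - p2 * q.2.1)
  have hP : P.Nonempty := by
    obtain ⟨v, hv, w, hw, h⟩ := hex
    exact ⟨(v, w), Finset.mem_filter.2 ⟨Finset.mk_mem_product hv hw, h⟩⟩
  let C : (ℤ × ℤ) × (ℤ × ℤ) → Finset (ℤ × ℤ) := fun q => B.filter (fun x =>
    0 ≤ q.1.1 * x.2 - q.1.2 * x.1 ∧ 0 ≤ x.1 * q.2.2 - x.2 * q.2.1)
  obtain ⟨⟨v, w⟩, hvw, hmin⟩ := P.exists_min_image (fun q => (C q).card) hP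
  obtain ⟨hmem, hd, hvp, hpw⟩ := Finset.mem_filter.1 hvw
  obtain ⟨hv, hw⟩ := Finset.mem_product.1 hmem
  simp only at hd hvp hpw hv hw
  have hno : ∀ x ∈ B, 0 < v.1 * x.2 - v.2 * x.1 → 0 < x.1 * w.2 - x.2 * w.1 → False := by
    intro x hx h1 h2
    rcases le_total 0 ((x.1 : ℝ) * p2 - x.2 * p1) with hxp | hxp
    · have := hmin (x, w) (Finset.mem_filter.2 ⟨Finset.mk_mem_product hx hw, h2, hxp, hpw⟩)
      refine absurd (Finset.card_lt_card ?_) (not_lt.2 this)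
      refine Finset.ssubset_iff_of_subset ?_ |>.2 ⟨v, ?_, ?_⟩
      · intro y hy
        obtain ⟨yB, y1, y2⟩ := Finset.mem_filter.1 hy
        simp only at y1 y2
        refine Finset.mem_filter.2 ⟨yB, ?_, y2⟩
        simp only
        have e : (v.1 * y.2 - v.2 * y.1) * (x.1 * w.2 - x.2 * w.1) =
          (v.1 * x.2 - v.2 * x.1) * (y.1 * w.2 - y.2 * w.1)
          + (v.1 * w.2 - v.2 * w.1) * (x.1 * y.2 - x.2 * y.1) := by ring
        refine nonneg_of_mul_nonneg_left (a := v.1 * y.2 - v.2 * y.1) ?_ h2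
        rw [e]
        positivity
      · refine Finset.mem_filter.2 ⟨hv, ?_, hd.le⟩
        simp only; linarith
      · intro hv'
        have := (Finset.mem_filter.1 hv').2.1
        simp only at this
        linarith
    · have := hmin (v, x) (Finset.mem_filter.2 ⟨Finset.mk_mem_product hv hx, h1, hvp,
        by simp only; linarith⟩)
      refine absurd (Finset.card_lt_card ?_) (not_lt.2 this)
      refine Finset.ssubset_iff_of_subset ?_ |>.2 ⟨w, ?_, ?_⟩
      · intro y hy
        obtain ⟨yB, y1, y2⟩ := Finset.mem_filter.1 hy
        simp only at y1 y2
        refine Finset.mem_filter.2 ⟨yB, y1, ?_⟩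
        simp only
        have e : (y.1 * w.2 - y.2 * w.1) * (v.1 * x.2 - v.2 * x.1) =
          (v.1 * y.2 - v.2 * y.1) * (x.1 * w.2 - x.2 * w.1)
          + (v.1 * w.2 - v.2 * w.1) * (y.1 * x.2 - y.2 * x.1) := by ring
        refine nonneg_of_mul_nonneg_left (a := y.1 * w.2 - y.2 * w.1) ?_ h1
        rw [e]
        positivity
      · refine Finset.mem_filter.2 ⟨hw, hd.le, ?_⟩
        simp only; linarith
      · intro hw'
        have := (Finset.mem_filter.1 hw').2.2
        simp only at this
        linarith
  have hvD := ((hB _).1 hv).1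
  have hwD := ((hB _).1 hw).1
  have hd1 : v.1 * w.2 - v.2 * w.1 = 1 := by
    by_contra hne
    obtain ⟨x1, x2, a, b, e1, e2, a0, b0, ad, bd, hab, hab0⟩ :=
      tri_point v.1 v.2 w.1 w.2 (v.1 * w.2 - v.2 * w.1) rfl (by omega)
    obtain ⟨d, hdd⟩ : ∃ d, d = v.1 * w.2 - v.2 * w.1 := ⟨_, rfl⟩
    rw [← hdd] at e1 e2 ad bd hab hd
    have hb : v.1 * x2 - v.2 * x1 = b := by
      apply mul_left_cancel₀ hd.ne'
      linear_combination v.1 * e2 - v.2 * e1 - b * hdd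
    have ha : x1 * w.2 - x2 * w.1 = a := by
      apply mul_left_cancel₀ hd.ne'
      linear_combination w.2 * e1 - w.1 * e2 - a * hdd
    have hx0 : ¬ (x1 = 0 ∧ x2 = 0) := by
      rintro ⟨rfl, rfl⟩
      simp at ha hb
      omega
    have hab' : ¬ (a + b < d) := fun hlt => hx0 (g.hB _ _ _ _ _ _ a b d hvD hwD a0 b0 hlt e1 e2)
    refine hno (x1, x2) ((hB _).2 ⟨g.hA _ _ _ _ _ _ a b d hvD hwD a0 b0 hab hd e1 e2, ?_⟩) ?_ ?_
    · intro h0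
      exact hx0 ⟨congrArg Prod.fst h0, congrArg Prod.snd h0⟩
    · simp only; omega
    · simp only; omega
  refine ⟨v, hv, w, hw, hd1, ?_, hvp, hpw⟩
  intro hs
  have e1 : v.1 * (v.2 + w.2) - v.2 * (v.1 + w.1) = 1 := by linear_combination hd1
  have e2 : (v.1 + w.1) * w.2 - (v.2 + w.2) * w.1 = 1 := by linear_combination hd1
  refine hno (v.1 + w.1, v.2 + w.2) ((hB _).2 ⟨hs, ?_⟩) ?_ ?_
  · intro h0
    have h1 : v.1 + w.1 = 0 := congrArg Prod.fst h0
    have h2 : v.2 + w.2 = 0 := congrArg Prod.snd h0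
    rw [h1, h2] at e1
    simp at e1
  · simp only; omega
  · simp only; omega

theorem vol_std : volume {q : ℝ × ℝ | 0 ≤ q.1 ∧ 0 ≤ q.2 ∧ q.1 + q.2 ≤ 1} ≤ ENNReal.ofReal (1 / 2) := by
  have hm : MeasurableSet {q : ℝ × ℝ | 0 ≤ q.1 ∧ 0 ≤ q.2 ∧ q.1 + q.2 ≤ 1} := by
    apply IsClosed.measurableSet
    apply IsClosed.inter (isClosed_le continuous_const continuous_fst)
    apply IsClosed.inter (isClosed_le continuous_const continuous_snd)
    exact isClosed_le (continuous_fst.add continuous_snd) continuous_const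
  rw [Measure.volume_eq_prod, Measure.prod_apply hm]
  have : ∀ x : ℝ, volume (Prod.mk x ⁻¹' {q : ℝ × ℝ | 0 ≤ q.1 ∧ 0 ≤ q.2 ∧ q.1 + q.2 ≤ 1}) ≤
      (Set.Icc (0 : ℝ) 1).indicator (fun x => ENNReal.ofReal (1 - x)) x := by
    intro x
    by_cases hx : x ∈ Set.Icc (0 : ℝ) 1
    · rw [Set.indicator_of_mem hx]
      refine le_trans (measure_mono (t := Set.Icc 0 (1 - x)) ?_) (by simp)
      rintro y ⟨h1, h2, h3⟩
      simp only at h1 h2 h3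
      exact ⟨h2, by linarith⟩
    · rw [Set.indicator_of_notMem hx]
      have : Prod.mk x ⁻¹' {q : ℝ × ℝ | 0 ≤ q.1 ∧ 0 ≤ q.2 ∧ q.1 + q.2 ≤ 1} = ∅ := by
        ext y
        simp only [Set.mem_preimage, Set.mem_ofPred_eq, Set.mem_empty_iff_false, iff_false]
        rintro ⟨h1, h2, h3⟩
        exact hx ⟨h1, by linarith⟩
      rw [this]; simp
  refine (lintegral_mono this).trans ?_
  rw [lintegral_indicator measurableSet_Icc]
  rw [← ofReal_integral_eq_lintegral_ofReal]
  · apply ENNReal.ofReal_le_ofReal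
    rw [integral_Icc_eq_integral_Ioc, ← intervalIntegral.integral_of_le (by norm_num)]
    rw [intervalIntegral.integral_sub (by simp) (by simp)]
    simp
    norm_num
  · exact (Continuous.integrableOn_Icc (by fun_prop))
  · filter_upwards [ae_restrict_mem measurableSet_Icc] with x hx
    simpa using hx.2

theorem vol_tri (v1 v2 w1 w2 : ℝ) (hd : v1 * w2 - v2 * w1 = 1) :
    volume {p : ℝ × ℝ | 0 ≤ p.1 * w2 - p.2 * w1 ∧ 0 ≤ v1 * p.2 - v2 * p.1 ∧
      (p.1 * w2 - p.2 * w1) + (v1 * p.2 - v2 * p.1) ≤ 1} ≤ ENNReal.ofReal (1 / 2) := by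
  let f := Matrix.toLin (Module.Basis.finTwoProd ℝ) (Module.Basis.finTwoProd ℝ) !![v1, w1; v2, w2]
  have hf : LinearMap.det f = 1 := by
    simp only [f, LinearMap.det_toLin, Matrix.det_fin_two_of]
    linarith
  have := Measure.addHaar_image_linearMap volume f {q : ℝ × ℝ | 0 ≤ q.1 ∧ 0 ≤ q.2 ∧ q.1 + q.2 ≤ 1}
  rw [hf] at this
  refine le_trans (measure_mono ?_) ((this.le.trans (by simp)).trans vol_std)
  rintro ⟨x, y⟩ ⟨h1, h2, h3⟩
  refine ⟨(x * w2 - y * w1, v1 * y - v2 * x), ⟨h1, h2, h3⟩, ?_⟩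
  simp only [f, Matrix.toLin_finTwoProd_apply]
  ext
  · simp only; linear_combination x * hd
  · simp only; linear_combination y * hd

theorem main0 (V : Set (ℝ × ℝ)) (hVfin : V.Finite)
    (hVlat : ∀ v ∈ V, ∃ a b : ℤ, v = ((a : ℝ), (b : ℝ)))
    (h0 : (0 : ℝ × ℝ) ∈ interior (convexHull ℝ V))
    (huniq : ∀ a b : ℤ, ((a : ℝ), (b : ℝ)) ∈ interior (convexHull ℝ V) → a = 0 ∧ b = 0) :
    volume (convexHull ℝ V) ≤ ENNReal.ofReal (9 / 2) := by
  classical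
  set Δ := convexHull ℝ V with hΔ
  have hconv : Convex ℝ Δ := convex_convexHull ℝ V
  have h0' : (0 : ℝ × ℝ) ∈ Δ := interior_subset h0
  let D : ℤ → ℤ → Prop := fun a b => ((a : ℝ), (b : ℝ)) ∈ Δ
  have comb : ∀ (x1 x2 y1 y2 z1 z2 m n N : ℤ), D y1 y2 → D z1 z2 → 0 ≤ m → 0 ≤ n → 0 < m + n →
      0 < N → N * x1 = m * y1 + n * z1 → N * x2 = m * y2 + n * z2 →
      ∃ q ∈ Δ, ((x1 : ℝ), (x2 : ℝ)) = (((m + n : ℤ) : ℝ) / N) • q := by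
    intro x1 x2 y1 y2 z1 z2 m n N hy hz hm hn hmn hN e1 e2
    have hm' : (0 : ℝ) ≤ m := by exact_mod_cast hm
    have hn' : (0 : ℝ) ≤ n := by exact_mod_cast hn
    have hmn' : (0 : ℝ) < m + n := by exact_mod_cast hmn
    have hN' : (0 : ℝ) < N := by exact_mod_cast hN
    have e1' : (N : ℝ) * x1 = m * y1 + n * z1 := by exact_mod_cast e1
    have e2' : (N : ℝ) * x2 = m * y2 + n * z2 := by exact_mod_cast e2
    refine ⟨((m : ℝ) / (m + n)) • ((y1 : ℝ), (y2 : ℝ)) + ((n : ℝ) / (m + n)) • ((z1 : ℝ), (z2 : ℝ)),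
      hconv hy hz (by positivity) (by positivity) (by field_simp), ?_⟩
    ext
    · simp
      field_simp
      linarith
    · simp
      field_simp
      linarith
  have g : GoodPts D := by
    constructor
    · intro x1 x2 y1 y2 z1 z2 m n N hy hz hm hn hmn hN e1 e2
      rcases (add_nonneg hm hn).eq_or_lt with h | h
      · obtain ⟨rfl, rfl⟩ : m = 0 ∧ n = 0 := by omega
        simp [hN.ne'] at e1 e2
        have e0 : (((x1 : ℝ), (x2 : ℝ)) : ℝ × ℝ) = 0 := by simp [e1, e2]
        simp only [D]
        rw [e0]
        exact h0'
      · obtain ⟨q, hq, e⟩ := comb x1 x2 y1 y2 z1 z2 m n N hy hz hm hn h hN e1 e2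
        have hN' : (0 : ℝ) < N := by exact_mod_cast hN
        have t0 : (0 : ℝ) ≤ ((m + n : ℤ) : ℝ) / N := div_nonneg (by exact_mod_cast h.le) hN'.le
        have t1 : ((m + n : ℤ) : ℝ) / N ≤ 1 := (div_le_one hN').2 (by exact_mod_cast hmn)
        have := hconv h0' hq (sub_nonneg.2 t1) t0 (by ring)
        rw [smul_zero, zero_add, ← e] at this
        exact this
    · intro x1 x2 y1 y2 z1 z2 m n N hy hz hm hn hmn e1 e2
      have hN : 0 < N := by omega
      rcases (add_nonneg hm hn).eq_or_lt with h | h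
      · obtain ⟨rfl, rfl⟩ : m = 0 ∧ n = 0 := by omega
        simp [hN.ne'] at e1 e2
        exact ⟨e1, e2⟩
      · obtain ⟨q, hq, e⟩ := comb x1 x2 y1 y2 z1 z2 m n N hy hz hm hn h hN e1 e2
        have hN' : (0 : ℝ) < N := by exact_mod_cast hN
        have t0 : (0 : ℝ) ≤ ((m + n : ℤ) : ℝ) / N := div_nonneg (by exact_mod_cast h.le) hN'.le
        have t1 : ((m + n : ℤ) : ℝ) / N < 1 := (div_lt_one hN').2 (by exact_mod_cast hmn)
        have := hconv.combo_interior_self_mem_interior h0 hq (sub_pos.2 t1) t0 (by ring)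
        rw [smul_zero, zero_add, ← e] at this
        exact huniq _ _ this
  -- linear inequalities pass to the hull
  have hlin : ∀ c1 c2 r : ℝ, (∀ a b, D a b → c1 * (a : ℝ) + c2 * (b : ℝ) ≤ r) →
      ∀ p ∈ Δ, c1 * p.1 + c2 * p.2 ≤ r := by
    intro c1 c2 r h
    let f : ℝ × ℝ →ₗ[ℝ] ℝ := c1 • LinearMap.fst ℝ ℝ ℝ + c2 • LinearMap.snd ℝ ℝ ℝ
    have hf : ∀ p, f p = c1 * p.1 + c2 * p.2 := by intro p; simp [f]
    have : Δ ⊆ {p | f p ≤ r} := by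
      apply convexHull_min _ (convex_halfSpace_le f.isLinear r)
      intro v hv
      obtain ⟨a, b, rfl⟩ := hVlat v hv
      rw [Set.mem_ofPred_eq, hf]
      exact h a b (subset_convexHull ℝ V hv)
    intro p hp
    have := this hp
    rwa [Set.mem_ofPred_eq, hf] at this
  have hC : ∀ c1 c2 : ℝ, (c1 ≠ 0 ∨ c2 ≠ 0) →
      ∃ a b, D a b ∧ 0 < c1 * (a : ℝ) + c2 * (b : ℝ) := by
    intro c1 c2 hc
    by_contra hcon
    push Not at hcon
    have H := hlin c1 c2 0 hcon
    have hcont : Continuous (fun t : ℝ => (t * c1, t * c2)) := by fun_prop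
    have hnh : (fun t : ℝ => (t * c1, t * c2)) ⁻¹' interior Δ ∈ nhds (0 : ℝ) := by
      apply hcont.continuousAt.preimage_mem_nhds
      apply isOpen_interior.mem_nhds
      have e0 : (((0 : ℝ) * c1, (0 : ℝ) * c2) : ℝ × ℝ) = 0 := by simp
      rw [e0]
      exact h0
    obtain ⟨ε, hε, hball⟩ := Metric.mem_nhds_iff.1 hnh
    have := hball (show ε / 2 ∈ Metric.ball (0 : ℝ) ε by
      rw [Metric.mem_ball, Real.dist_eq, sub_zero, abs_of_pos (by positivity)]; linarith)
    have := H _ (interior_subset this)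
    simp only at this
    have h2 : 0 < ε / 2 * (c1 ^ 2 + c2 ^ 2) := by
      rcases hc with h | h <;> positivity
    linarith
  -- finiteness
  have hbd : Bornology.IsBounded Δ := (isBounded_convexHull).2 hVfin.isBounded
  have hfin : {p : ℤ × ℤ | D p.1 p.2 ∧ p ≠ 0}.Finite := by
    obtain ⟨R, hR⟩ := hbd.subset_closedBall 0
    refine ((Set.finite_Icc (-⌈R⌉) ⌈R⌉).prod (Set.finite_Icc (-⌈R⌉) ⌈R⌉)).subset ?_
    rintro ⟨a, b⟩ ⟨h, -⟩
    have h1 := hR h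
    rw [mem_closedBall_zero_iff, Prod.norm_def, max_le_iff] at h1
    simp only [Real.norm_eq_abs, abs_le] at h1
    have hc := Int.le_ceil R
    refine ⟨⟨?_, ?_⟩, ⟨?_, ?_⟩⟩
    · have : (-⌈R⌉ : ℝ) ≤ a := by linarith [h1.1.1]
      exact_mod_cast this
    · have : (a : ℝ) ≤ ⌈R⌉ := by linarith [h1.1.2]
      exact_mod_cast this
    · have : (-⌈R⌉ : ℝ) ≤ b := by linarith [h1.2.1]
      exact_mod_cast this
    · have : (b : ℝ) ≤ ⌈R⌉ := by linarith [h1.2.2]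
      exact_mod_cast this
  let B := hfin.toFinset
  have hB : ∀ p, p ∈ B ↔ D p.1 p.2 ∧ p ≠ 0 := by intro p; simp [B]
  have hcard : B.card ≤ 9 := card_le_nine D g hC B (fun p hp => (hB p).1 hp)
  let T := (B ×ˢ B).filter (fun q => q.1.1 * q.2.2 - q.1.2 * q.2.1 = 1 ∧
    ¬ D (q.1.1 + q.2.1) (q.1.2 + q.2.2))
  have hT : T.card ≤ 9 := by
    refine le_trans (Finset.card_le_card_of_injOn (t := B) Prod.fst ?_ ?_) hcard
    · intro q hq
      exact (Finset.mem_product.1 (Finset.mem_filter.1 hq).1).1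
    · rintro ⟨v, w⟩ hq ⟨v', w'⟩ hq' hvv
      simp only at hvv
      subst hvv
      obtain ⟨hm, hd, hs⟩ := Finset.mem_filter.1 hq
      obtain ⟨hm', hd', hs'⟩ := Finset.mem_filter.1 hq'
      simp only at hd hd' hs hs'
      have hv := ((hB _).1 (Finset.mem_product.1 hm).1).1
      have hw := ((hB _).1 (Finset.mem_product.1 hm).2).1
      have hw' := ((hB _).1 (Finset.mem_product.1 hm').2).1
      simp only at hv hw hw'
      have f1 := facet D g _ _ _ _ hv hw hd hs _ _ hw'
      have f2 := facet D g _ _ _ _ hv hw' hd' hs' _ _ hw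
      have hz : w'.1 * w.2 - w'.2 * w.1 = 0 := by linarith
      have k1 : w.1 = w'.1 := by
        linear_combination w.1 * (-1) * hd' + w'.1 * hd - v.1 * hz
      have k2 : w.2 = w'.2 := by
        linear_combination w.2 * (-1) * hd' + w'.2 * hd - v.2 * hz
      rw [Prod.ext k1 k2]
  let tri : (ℤ × ℤ) × (ℤ × ℤ) → Set (ℝ × ℝ) := fun q =>
    {p : ℝ × ℝ | 0 ≤ p.1 * q.2.2 - p.2 * q.2.1 ∧ 0 ≤ q.1.1 * p.2 - q.1.2 * p.1 ∧
      (p.1 * q.2.2 - p.2 * q.2.1) + (q.1.1 * p.2 - q.1.2 * p.1) ≤ 1}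
  have hcov : Δ ⊆ {0} ∪ ⋃ q ∈ T, tri q := by
    intro p hp
    by_cases hp0 : p = 0
    · left; exact hp0
    right
    have hp' : p.1 ≠ 0 ∨ p.2 ≠ 0 := by
      by_contra hc
      push Not at hc
      exact hp0 (Prod.ext hc.1 hc.2)
    obtain ⟨v, hv, w, hw, hd, hs, i1, i2⟩ := cone_exists D g hC B hB p.1 p.2 hp'
    refine Set.mem_biUnion (x := (v, w))
      (Finset.mem_filter.2 ⟨Finset.mk_mem_product hv hw, hd, hs⟩) ⟨i2, i1, ?_⟩
    have := hlin ((w.2 : ℝ) - v.2) ((v.1 : ℝ) - w.1) 1 (by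
      intro a b hab
      have := facet D g _ _ _ _ ((hB _).1 hv).1 ((hB _).1 hw).1 hd hs a b hab
      have : ((a : ℝ) * w.2 - b * w.1) + (v.1 * b - v.2 * a) ≤ 1 := by exact_mod_cast this
      linarith) p hp
    simp only
    linarith
  calc volume Δ ≤ volume ({0} ∪ ⋃ q ∈ T, tri q) := measure_mono hcov
    _ ≤ volume {(0 : ℝ × ℝ)} + volume (⋃ q ∈ T, tri q) := measure_union_le _ _
    _ = volume (⋃ q ∈ T, tri q) := by simp
    _ ≤ ∑ q ∈ T, volume (tri q) := measure_biUnion_finset_le _ _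
    _ ≤ ∑ q ∈ T, ENNReal.ofReal (1 / 2) := by
        apply Finset.sum_le_sum
        intro q hq
        apply vol_tri
        exact_mod_cast (Finset.mem_filter.1 hq).2.1
    _ = T.card * ENNReal.ofReal (1 / 2) := by simp
    _ = ENNReal.ofReal (T.card * (1 / 2)) := by
        rw [ENNReal.ofReal_mul (by positivity), ENNReal.ofReal_natCast]
    _ ≤ ENNReal.ofReal (9 / 2) := by
        apply ENNReal.ofReal_le_ofReal
        have : (T.card : ℝ) ≤ 9 := by exact_mod_cast hT
        linarith

/-- A convex lattice polygon with exactly one interior lattice point has area at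
most `9/2`. -/
theorem area_le_of_one_interior_lattice_point (V : Set (ℝ × ℝ)) (hVfin : V.Finite)
    (hVlat : ∀ v ∈ V, ∃ a b : ℤ, v = ((a : ℝ), (b : ℝ)))
    (Δ : Set (ℝ × ℝ)) (hΔ : Δ = convexHull ℝ V)
    (hone : Nat.card {p : ℤ × ℤ // ((p.1 : ℝ), (p.2 : ℝ)) ∈ interior Δ} = 1) :
    (volume Δ).toReal ≤ 9 / 2 := by
  subst hΔ
  obtain ⟨hsub, ⟨⟨c1, c2⟩, hc⟩⟩ := Nat.card_eq_one_iff_unique.1 hone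
  simp only at hc
  let c : ℝ × ℝ := ((c1 : ℝ), (c2 : ℝ))
  have hull : convexHull ℝ ((fun x => -c + x) '' V) = (fun x => -c + x) '' convexHull ℝ V := by
    have := convexHull_vadd (-c) V (𝕜 := ℝ)
    exact this
  have hinter : interior ((fun x => -c + x) '' convexHull ℝ V)
      = (fun x => -c + x) '' interior (convexHull ℝ V) :=
    ((Homeomorph.addLeft (-c)).image_interior _).symm
  have key := main0 ((fun x => -c + x) '' V) (hVfin.image _) ?_ ?_ ?_
  · rw [hull] at key
    have e : volume ((fun x => -c + x) '' convexHull ℝ V) = volume (convexHull ℝ V) := by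
      simp [Set.image_add_left]
    rw [e] at key
    exact ENNReal.toReal_le_of_le_ofReal (by norm_num) key
  · rintro _ ⟨v, hv, rfl⟩
    obtain ⟨a, b, rfl⟩ := hVlat v hv
    refine ⟨-c1 + a, -c2 + b, ?_⟩
    simp [c]
  · rw [hull, hinter]
    exact ⟨c, hc, by simp⟩
  · intro a b h
    rw [hull, hinter] at h
    obtain ⟨y, hy, hyy⟩ := h
    have hy' : y = (((a + c1 : ℤ) : ℝ), ((b + c2 : ℤ) : ℝ)) := by
      have : y = c + ((a : ℝ), (b : ℝ)) := by rw [← hyy]; simp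
      rw [this]
      ext <;> simp [c, add_comm]
    rw [hy'] at hy
    have := hsub.elim ⟨(a + c1, b + c2), hy⟩ ⟨(c1, c2), hc⟩
    simpa using this
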